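/- Let A be a linear operator on the space of polynomial functions on ℝᴺ that is symmetric with respect to the inner product ⟨h₁,h₂⟩ = ∫ h₁h₂ γ dv (i.e. ⟨A p, q⟩ = ⟨p, A q⟩ for all polynomials p, q) and that maps, for each l, the space P_{2l} of even homogeneous polynomials of degree 2l in v₁,…,v_N into itself. Suppose that for a multi-index α with |α| = l one has A(v₁^{2α₁}⋯v_N^{2α_N}) = Σ_{|β|=l} c_β v₁^{2β₁}⋯v_N^{2β_N}. Then A(H_{2α₁}(v₁)⋯H_{2α_N}(v_N)) = Σ_{|β|=l} c_β H_{2β₁}(v₁)⋯H_{2β_N}(v_N). -/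

import Mathlib

open MeasureTheory Real
open scoped BigOperators

noncomputable section

/-- standard Gaussian density on ℝ -/
def g (v : ℝ) : ℝ := (Real.sqrt (2 * Real.pi))⁻¹ * Real.exp (-v ^ 2 / 2)

/-- product Gaussian density on ℝᴺ -/
def gam (N : ℕ) (v : Fin N → ℝ) : ℝ := ∏ i, g (v i)

/-- the Gaussian measure γ(v)dv on ℝᴺ -/
def gmeas (N : ℕ) : Measure (Fin N → ℝ) :=
  volume.withDensity (fun v => ENNReal.ofReal (gam N v))

/-- average over θ ∈ [0, 2π] -/
def avg (F : ℝ → ℝ) : ℝ := (2 * Real.pi)⁻¹ * ∫ θ in (0:ℝ)..(2 * Real.pi), F θ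

/-- v with coordinates i,j rotated by angle θ -/
def rot (N : ℕ) (v : Fin N → ℝ) (i j : Fin N) (θ : ℝ) : Fin N → ℝ :=
  Function.update (Function.update v i (v i * Real.cos θ + v j * Real.sin θ)) j
    (-(v i) * Real.sin θ + v j * Real.cos θ)

/-- the Kac collision operator Q -/
def Qop (N : ℕ) (h : (Fin N → ℝ) → ℝ) (v : Fin N → ℝ) : ℝ :=
  ((N.choose 2 : ℝ))⁻¹ * ∑ i : Fin N, ∑ j : Fin N,
    if i < j then avg (fun θ => h (rot N v i j θ)) else 0

/-- 𝓛_K = N (I - Q) -/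
def LK (N : ℕ) (h : (Fin N → ℝ) → ℝ) (v : Fin N → ℝ) : ℝ :=
  (N : ℝ) * (h v - Qop N h v)

/-- v with j-th coordinate replaced by v_j cos θ + w sin θ -/
def rotw (N : ℕ) (v : Fin N → ℝ) (j : Fin N) (θ w : ℝ) : Fin N → ℝ :=
  Function.update v j (v j * Real.cos θ + w * Real.sin θ)

/-- the thermostat operator T_j -/
def Tj (N : ℕ) (j : Fin N) (h : (Fin N → ℝ) → ℝ) (v : Fin N → ℝ) : ℝ :=
  ∫ w : ℝ, g w * avg (fun θ => h (rotw N v j θ w))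

/-- 𝓛_T = Σ_j (I - T_j) -/
def LTherm (N : ℕ) (h : (Fin N → ℝ) → ℝ) (v : Fin N → ℝ) : ℝ :=
  ∑ j : Fin N, (h v - Tj N j h v)

/-- inner product on L²(ℝᴺ, γ dv) -/
def iprod (N : ℕ) (h₁ h₂ : (Fin N → ℝ) → ℝ) : ℝ :=
  ∫ v : Fin N → ℝ, h₁ v * h₂ v * gam N v

/-- probabilist's Hermite polynomial H_α(v) = (−1)ᵅ e^{v²/2} (d/dv)ᵅ e^{−v²/2} -/
def Herm (n : ℕ) (v : ℝ) : ℝ :=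
  (-1 : ℝ) ^ n * Real.exp (v ^ 2 / 2) * iteratedDeriv n (fun x => Real.exp (-x ^ 2 / 2)) v

/-- s_n = (2π)⁻¹ ∫₀^{2π} cosⁿ θ dθ -/
def sCoef (n : ℕ) : ℝ := avg (fun θ => Real.cos θ ^ n)

/-- the master-equation thermostat operator R_j acting on densities -/
def Rop (N : ℕ) (j : Fin N) (f : (Fin N → ℝ) → ℝ) (v : Fin N → ℝ) : ℝ :=
  ∫ w : ℝ, avg (fun θ =>
    g (-(v j) * Real.sin θ + w * Real.cos θ) * f (rotw N v j θ w))

/-- relative entropy S(f|γ) -/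
def relEnt (N : ℕ) (f : (Fin N → ℝ) → ℝ) : ℝ :=
  ∫ v : Fin N → ℝ, f v * Real.log (f v / gam N v)

/-- A function on ℝᴺ given by an even homogeneous polynomial of degree 2l
(i.e. a member of P_{2l}). -/
def IsEvenHomog (N l : ℕ) (p : (Fin N → ℝ) → ℝ) : Prop :=
  ∃ P : MvPolynomial (Fin N) ℝ, P.IsHomogeneous (2 * l) ∧
    (∀ v, p v = MvPolynomial.eval v P) ∧
    ∀ (v : Fin N → ℝ) (i : Fin N), p (Function.update v i (-(v i))) = p v

/-- A function on ℝᴺ given by a real polynomial. -/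
def IsPolyFun (N : ℕ) (p : (Fin N → ℝ) → ℝ) : Prop :=
  ∃ P : MvPolynomial (Fin N) ℝ, ∀ v, p v = MvPolynomial.eval v P

/-- The Hermite polynomial with real coefficients. -/
def hermiteReal (n : ℕ) : Polynomial ℝ := (Polynomial.hermite n).map (Int.castRingHom ℝ)

theorem Herm_eq_eval (n : ℕ) (x : ℝ) : Herm n x = (hermiteReal n).eval x := by
  have h := Polynomial.hermite_eq_deriv_gaussian' n x
  rw [hermiteReal, Polynomial.eval_map, ← algebraMap_int_eq, ← Polynomial.aeval_def, h, Herm,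
    iteratedDeriv_eq_iterate]
  simp only [neg_div]
  ring

theorem continuous_g : Continuous g := by
  unfold g
  fun_prop

theorem g_pos (x : ℝ) : 0 < g x := by
  unfold g
  positivity

theorem hasDerivAt_g (x : ℝ) : HasDerivAt g (-x * g x) x := by
  have h1 : HasDerivAt (fun y : ℝ => -y ^ 2 / 2) (-x) x := by
    refine ((hasDerivAt_pow 2 x).fun_neg.div_const 2).congr_deriv ?_
    simp
    ring
  refine (h1.exp.const_mul (Real.sqrt (2 * Real.pi))⁻¹).congr_deriv ?_
  simp only [g]
  ring

theorem integrable_pow_mul_g (n : ℕ) : Integrable (fun x : ℝ => x ^ n * g x) := by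
  have h := (integrable_rpow_mul_exp_neg_mul_sq (b := 1 / 2) (by norm_num) (s := n)
    (by have : (0 : ℝ) ≤ n := Nat.cast_nonneg n
        linarith)).const_mul (Real.sqrt (2 * Real.pi))⁻¹
  refine h.congr (Filter.Eventually.of_forall fun x => ?_)
  simp only [g, Real.rpow_natCast]
  rw [show -(1 / 2) * x ^ 2 = -x ^ 2 / 2 by ring]
  ring

theorem integrable_eval_mul_g (p : Polynomial ℝ) :
    Integrable (fun x : ℝ => p.eval x * g x) := by
  simp only [Polynomial.eval_eq_sum_range, Finset.sum_mul, mul_assoc]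
  exact integrable_finsetSum _ fun i _ => (integrable_pow_mul_g i).const_mul _

theorem integral_mul_hermiteReal_succ (p : Polynomial ℝ) (n : ℕ) :
    ∫ x, (p * hermiteReal (n + 1)).eval x * g x
      = ∫ x, (p.derivative * hermiteReal n).eval x * g x := by
  have hs : hermiteReal (n + 1)
      = Polynomial.X * hermiteReal n - (hermiteReal n).derivative := by
    simp [hermiteReal, Polynomial.hermite_succ, Polynomial.derivative_map]
  have hd : ∀ x, HasDerivAt (fun x => (p * hermiteReal n).eval x * g x)
      ((p.derivative * hermiteReal n).eval x * g x - (p * hermiteReal (n + 1)).eval x * g x) x := by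
    intro x
    convert! ((p * hermiteReal n).hasDerivAt x).mul (hasDerivAt_g x) using 1
    rw [hs]
    simp only [Polynomial.derivative_mul, Polynomial.eval_add, Polynomial.eval_mul,
      Polynomial.eval_sub, Polynomial.eval_X]
    ring
  have h0 := integral_eq_zero_of_hasDerivAt_of_integrable hd
    ((integrable_eval_mul_g _).sub (integrable_eval_mul_g _)) (integrable_eval_mul_g _)
  rw [integral_sub (integrable_eval_mul_g _) (integrable_eval_mul_g _)] at h0
  linarith

theorem integral_mul_hermiteReal_eq_zero (n : ℕ) :
    ∀ p : Polynomial ℝ, p.degree < n → ∫ x, (p * hermiteReal n).eval x * g x = 0 := by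
  induction n with
  | zero =>
    intro p hp
    have : p = 0 := by simpa using hp
    simp [this]
  | succ n ih =>
    intro p hp
    rw [integral_mul_hermiteReal_succ]
    by_cases h : p = 0
    · simp [h]
    · apply ih
      refine (Polynomial.degree_derivative_lt h).trans_le ?_
      rw [Polynomial.degree_eq_natDegree h] at hp ⊢
      exact_mod_cast Nat.lt_succ_iff.1 (by exact_mod_cast hp)

theorem integral_Herm_mul_pow_eq_zero {n k : ℕ} (h : k < n) :
    ∫ x, Herm n x * x ^ k * g x = 0 := by
  rw [← integral_mul_hermiteReal_eq_zero n (Polynomial.X ^ k) (by simpa using h)]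
  simp [Herm_eq_eval, mul_comm]

theorem sum_range_two_mul_add_one {M : Type*} [AddCommMonoid M] (f : ℕ → M)
    (hf : ∀ i, Odd i → f i = 0) (k : ℕ) :
    ∑ i ∈ Finset.range (2 * k + 1), f i = ∑ j ∈ Finset.range (k + 1), f (2 * j) := by
  induction k with
  | zero => simp
  | succ k ih =>
    rw [Finset.sum_range_succ _ (k + 1), ← ih, show 2 * (k + 1) + 1 = 2 * k + 1 + 1 + 1 by ring,
      Finset.sum_range_succ, Finset.sum_range_succ, hf (2 * k + 1) ⟨k, rfl⟩, add_zero]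
    rfl

theorem Herm_two_mul (k : ℕ) (x : ℝ) :
    Herm (2 * k) x
      = ∑ j ∈ Finset.range (k + 1), (hermiteReal (2 * k)).coeff (2 * j) * x ^ (2 * j) := by
  have hdeg : (hermiteReal (2 * k)).natDegree = 2 * k := by
    rw [hermiteReal, (Polynomial.hermite_monic _).natDegree_map, Polynomial.natDegree_hermite]
  rw [Herm_eq_eval, Polynomial.eval_eq_sum_range, hdeg]
  refine sum_range_two_mul_add_one
    (fun i => (hermiteReal (2 * k)).coeff i * x ^ i) (fun i hi => ?_) k
  have : Odd (2 * k + i) := (even_two_mul k).add_odd hi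
  rw [hermiteReal, Polynomial.coeff_map, Polynomial.coeff_hermite_of_odd_add this]
  simp

theorem hermiteReal_coeff_self (n : ℕ) : (hermiteReal n).coeff n = 1 := by
  simp [hermiteReal]

section PolyFun

variable {N : ℕ}

theorem gam_pos (v : Fin N → ℝ) : 0 < gam N v := Finset.prod_pos fun _ _ => g_pos _

theorem continuous_gam : Continuous (gam N) :=
  continuous_finsetProd _ fun i _ => continuous_g.comp (continuous_apply i)

theorem integrable_eval_mul_gam (P : MvPolynomial (Fin N) ℝ) :
    Integrable (fun v : Fin N → ℝ => MvPolynomial.eval v P * gam N v) := by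
  simp only [MvPolynomial.eval_eq', Finset.sum_mul, mul_assoc]
  refine integrable_finsetSum _ fun d _ => Integrable.const_mul ?_ _
  simp only [gam, ← Finset.prod_mul_distrib]
  exact Integrable.fintype_prod (f := fun i x => x ^ d i * g x) fun i => integrable_pow_mul_g _

namespace IsPolyFun

variable {p q : (Fin N → ℝ) → ℝ}

theorem zero : IsPolyFun N 0 := ⟨0, by simp⟩

theorem add (hp : IsPolyFun N p) (hq : IsPolyFun N q) : IsPolyFun N (p + q) := by
  obtain ⟨P, hP⟩ := hp
  obtain ⟨Q, hQ⟩ := hq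
  exact ⟨P + Q, by simp [hP, hQ]⟩

theorem smul (c : ℝ) (hp : IsPolyFun N p) : IsPolyFun N (c • p) := by
  obtain ⟨P, hP⟩ := hp
  exact ⟨c • P, by simp [hP, MvPolynomial.smul_eval]⟩

theorem prod_eval (P : Fin N → Polynomial ℝ) : IsPolyFun N (fun v => ∏ i, (P i).eval (v i)) := by
  refine ⟨∏ i, (P i).toMvPolynomial i, fun v => ?_⟩
  simp [MvPolynomial.eval_toMvPolynomial]

theorem integrable (hp : IsPolyFun N p) (hq : IsPolyFun N q) :
    Integrable (fun v => p v * q v * gam N v) := by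
  obtain ⟨P, hP⟩ := hp
  obtain ⟨Q, hQ⟩ := hq
  simpa [hP, hQ] using integrable_eval_mul_gam (P * Q)

theorem eq_zero_of_iprod_self (hp : IsPolyFun N p) (h : iprod N p p = 0) : p = 0 := by
  have hint := hp.integrable hp
  have hcont : Continuous p := by
    obtain ⟨P, hP⟩ := hp
    rw [funext hP]
    exact MvPolynomial.continuous_eval P
  have hae := (integral_eq_zero_iff_of_nonneg
    (fun v => mul_nonneg (mul_self_nonneg (p v)) (gam_pos v).le) hint).1 h
  have heq := (Continuous.ae_eq_iff_eq volume ((hcont.mul hcont).mul continuous_gam)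
    continuous_zero).1 hae
  funext v
  simpa [(gam_pos v).ne'] using congrFun heq v

end IsPolyFun

theorem iprod_comm (p q : (Fin N → ℝ) → ℝ) : iprod N p q = iprod N q p := by
  simp only [iprod, mul_comm (p _)]

theorem isPolyFun_prod_Herm (β : Fin N → ℕ) :
    IsPolyFun N (fun v => ∏ i, Herm (2 * β i) (v i)) := by
  simpa only [Herm_eq_eval] using IsPolyFun.prod_eval fun i => hermiteReal (2 * β i)

/-- The polynomial functions orthogonal to a given polynomial function. -/
def polyOrth {q : (Fin N → ℝ) → ℝ} (hq : IsPolyFun N q) : Submodule ℝ ((Fin N → ℝ) → ℝ) where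
  carrier := {p | IsPolyFun N p ∧ iprod N p q = 0}
  zero_mem' := ⟨.zero, by simp [iprod]⟩
  add_mem' := by
    rintro a b ⟨ha, ha0⟩ ⟨hb, hb0⟩
    refine ⟨ha.add hb, ?_⟩
    have h := integral_add (ha.integrable hq) (hb.integrable hq)
    simp only [iprod] at ha0 hb0
    rw [ha0, hb0, add_zero] at h
    rw [← h]
    simp only [iprod, Pi.add_apply, add_mul]
  smul_mem' := by
    rintro c a ⟨ha, ha0⟩
    refine ⟨ha.smul c, ?_⟩
    have h := integral_const_mul (μ := volume) c (fun v => a v * q v * gam N v)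
    simp only [iprod] at ha0
    rw [ha0, mul_zero] at h
    rw [← h]
    simp only [iprod, Pi.smul_apply, smul_eq_mul, mul_assoc]

variable (N) in
/-- The span of the even homogeneous polynomials of degree less than `2 * l`. -/
def evenLower (l : ℕ) : Submodule ℝ ((Fin N → ℝ) → ℝ) :=
  Submodule.span ℝ {p | ∃ m < l, IsEvenHomog N m p}

theorem IsPolyFun.of_mem_evenLower {l : ℕ} {p : (Fin N → ℝ) → ℝ} (hp : p ∈ evenLower N l) :
    IsPolyFun N p := by
  induction hp using Submodule.span_induction with
  | mem p h =>
    obtain ⟨m, -, P, -, hP, -⟩ := h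
    exact ⟨P, hP⟩
  | zero => exact .zero
  | add p q _ _ hp hq => exact hp.add hq
  | smul c p _ hp => exact hp.smul c

theorem map_mem_evenLower {A : ((Fin N → ℝ) → ℝ) →ₗ[ℝ] ((Fin N → ℝ) → ℝ)}
    (hpres : ∀ (l : ℕ) (p : (Fin N → ℝ) → ℝ), IsEvenHomog N l p → IsEvenHomog N l (A p))
    {l : ℕ} {p : (Fin N → ℝ) → ℝ} (hp : p ∈ evenLower N l) : A p ∈ evenLower N l := by
  have h : evenLower N l ≤ (evenLower N l).comap A := by
    refine Submodule.span_le.2 ?_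
    rintro p ⟨m, hm, hp⟩
    exact Submodule.subset_span ⟨m, hm, hpres m p hp⟩
  exact h hp

theorem isEvenHomog_prod_pow (β : Fin N → ℕ) :
    IsEvenHomog N (∑ i, β i) (fun v => ∏ i, v i ^ (2 * β i)) := by
  refine ⟨∏ i, MvPolynomial.X i ^ (2 * β i), ?_, fun v => by simp, ?_⟩
  · rw [Finset.mul_sum]
    refine MvPolynomial.IsHomogeneous.prod _ _ _ fun i _ => ?_
    simpa using (MvPolynomial.isHomogeneous_X ℝ i).pow (2 * β i)
  · intro v i
    refine Finset.prod_congr rfl fun j _ => ?_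
    by_cases h : j = i
    · subst h
      simp [pow_mul]
    · simp [h]

theorem prod_Herm_sub_prod_pow_mem (β : Fin N → ℕ) :
    ((fun v => ∏ i, Herm (2 * β i) (v i)) - fun v => ∏ i, v i ^ (2 * β i))
      ∈ evenLower N (∑ i, β i) := by
  set s := Fintype.piFinset fun i => Finset.range (β i + 1) with hs
  have hβ : β ∈ s := by simp [hs]
  have key : ((fun v => ∏ i, Herm (2 * β i) (v i)) - fun v : Fin N → ℝ => ∏ i, v i ^ (2 * β i))
      = ∑ δ ∈ s.erase β, (∏ i, (hermiteReal (2 * β i)).coeff (2 * δ i)) •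
          fun v : Fin N → ℝ => ∏ i, v i ^ (2 * δ i) := by
    funext v
    simp only [Pi.sub_apply, Herm_two_mul, Finset.prod_univ_sum, Finset.sum_apply, Pi.smul_apply,
      smul_eq_mul, Finset.prod_mul_distrib]
    rw [← hs, ← Finset.add_sum_erase _ _ hβ]
    simp [hermiteReal_coeff_self]
  rw [key]
  refine Submodule.sum_mem _ fun δ hδ => Submodule.smul_mem _ _ (Submodule.subset_span
    ⟨_, ?_, isEvenHomog_prod_pow δ⟩)
  obtain ⟨hne, hmem⟩ := Finset.mem_erase.1 hδ
  have hle : ∀ i, δ i ≤ β i := fun i => by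
    have := Fintype.mem_piFinset.1 hmem i
    simpa [Nat.lt_succ_iff] using this
  obtain ⟨i, hi⟩ := Function.ne_iff.1 hne
  exact Finset.sum_lt_sum (fun i _ => hle i) ⟨i, Finset.mem_univ _, lt_of_le_of_ne (hle i) hi⟩

theorem evenLower_le_polyOrth (β : Fin N → ℕ) :
    evenLower N (∑ i, β i) ≤ polyOrth (isPolyFun_prod_Herm β) := by
  refine Submodule.span_le.2 ?_
  rintro p ⟨m, hm, P, hhom, hP, -⟩
  have hp : p = ∑ d ∈ P.support, P.coeff d • fun v : Fin N → ℝ => ∏ i, v i ^ d i := by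
    funext v
    simp [hP, MvPolynomial.eval_eq']
  rw [hp]
  refine Submodule.sum_mem _ fun d hd => Submodule.smul_mem _ _ ⟨?_, ?_⟩
  · simpa using IsPolyFun.prod_eval fun i => (Polynomial.X : Polynomial ℝ) ^ d i
  · have hdeg : ∑ i, d i = 2 * m := by
      rw [← hhom (MvPolynomial.mem_support_iff.1 hd), Finsupp.weight_apply,
        Finsupp.sum_fintype _ _ (by simp)]
      simp
    obtain ⟨i, -, hi⟩ : ∃ i ∈ Finset.univ, d i < 2 * β i := by
      refine Finset.exists_lt_of_sum_lt ?_
      rw [hdeg, ← Finset.mul_sum]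
      lia
    rw [iprod_comm]
    simp only [iprod, gam, ← Finset.prod_mul_distrib]
    rw [integral_fintype_prod_volume_eq_prod (f := fun i x => Herm (2 * β i) x * x ^ d i * g x)]
    exact Finset.prod_eq_zero (Finset.mem_univ i) (integral_Herm_mul_pow_eq_zero hi)

end PolyFun


/-- a symmetric operator preserving each P_{2l} acts on products of
(even) Hermite polynomials with the same coefficients as on the corresponding
monomials. -/
theorem symmetric_operator_monomials_to_hermite (N : ℕ) (hN : 1 ≤ N)
    (A : ((Fin N → ℝ) → ℝ) →ₗ[ℝ] ((Fin N → ℝ) → ℝ))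
    (hsym : ∀ p q : (Fin N → ℝ) → ℝ,
      (∃ P : MvPolynomial (Fin N) ℝ, ∀ v, p v = MvPolynomial.eval v P) →
      (∃ P : MvPolynomial (Fin N) ℝ, ∀ v, q v = MvPolynomial.eval v P) →
      iprod N (A p) q = iprod N p (A q))
    (hpres : ∀ (l : ℕ) (p : (Fin N → ℝ) → ℝ),
      IsEvenHomog N l p → IsEvenHomog N l (A p))
    (l : ℕ) (α : Fin N → ℕ) (hα : ∑ i, α i = l)
    (c : (Fin N → ℕ) → ℝ)
    (hmono : ∀ v, A (fun u => ∏ i, u i ^ (2 * α i)) v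
      = ∑ β ∈ Finset.Nat.antidiagonalTuple N l, c β * ∏ i, v i ^ (2 * β i)) :
    ∀ v, A (fun u => ∏ i, Herm (2 * α i) (u i)) v
      = ∑ β ∈ Finset.Nat.antidiagonalTuple N l, c β * ∏ i, Herm (2 * β i) (v i) := by
  subst hα
  set H : (Fin N → ℕ) → (Fin N → ℝ) → ℝ := fun β v => ∏ i, Herm (2 * β i) (v i) with hH
  set M : (Fin N → ℕ) → (Fin N → ℝ) → ℝ := fun β v => ∏ i, v i ^ (2 * β i) with hM
  set T := Finset.Nat.antidiagonalTuple N (∑ i, α i) with hT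
  have hsum : ∀ β ∈ T, ∑ i, β i = ∑ i, α i := fun β hβ => by
    simpa using Finset.Nat.mem_antidiagonalTuple.1 hβ
  have hAM : A (M α) = ∑ β ∈ T, c β • M β := by
    funext v
    simpa [hM] using hmono v
  have hD : A (H α) - ∑ β ∈ T, c β • H β ∈ evenLower N (∑ i, α i) := by
    have h : A (H α) - ∑ β ∈ T, c β • H β
        = A (H α - M α) - ∑ β ∈ T, c β • (H β - M β) := by
      simp only [map_sub, hAM, smul_sub, Finset.sum_sub_distrib]
      abel
    rw [h]
    refine Submodule.sub_mem _ (map_mem_evenLower hpres (prod_Herm_sub_prod_pow_mem α))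
      (Submodule.sum_mem _ fun β hβ => Submodule.smul_mem _ _ ?_)
    rw [← hsum β hβ]
    exact prod_Herm_sub_prod_pow_mem β
  have hDpoly := IsPolyFun.of_mem_evenLower hD
  have hAH : A (H α) ∈ polyOrth hDpoly := by
    refine ⟨?_, ?_⟩
    · have hpoly : IsPolyFun N (∑ β ∈ T, c β • H β) :=
        Finset.sum_induction _ (IsPolyFun N) (fun _ _ => IsPolyFun.add) .zero
          fun β _ => (isPolyFun_prod_Herm β).smul _
      simpa using hDpoly.add hpoly
    · rw [hsym _ _ (isPolyFun_prod_Herm α) hDpoly, iprod_comm]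
      exact (evenLower_le_polyOrth α (map_mem_evenLower hpres hD)).2
  have hS : ∑ β ∈ T, c β • H β ∈ polyOrth hDpoly := by
    refine Submodule.sum_mem _ fun β hβ => Submodule.smul_mem _ _ ⟨isPolyFun_prod_Herm β, ?_⟩
    rw [iprod_comm]
    refine (evenLower_le_polyOrth β ?_).2
    rw [hsum β hβ]
    exact hD
  have hzero := hDpoly.eq_zero_of_iprod_self (Submodule.sub_mem _ hAH hS).2
  intro v
  have hv := congrFun (sub_eq_zero.1 hzero) v
  simpa [hH] using hv

end
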